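/- arXiv:1612.06491 — 2 statements merged into one kernel-verified Lean document; each statement's English description precedes it below -/
import Mathlib

section
/- Let S be a nonzero ℂ-linear subspace of the m×n complex matrices. Then mrk(S ⊗ S) > mrk(S)² holds if and only if both mrk(S) < dim Im(S) and mrk(S) < n − dim Ker(S). -/
open Matrix

noncomputable def mrk {m n : Type*} [Fintype m] [Fintype n]
    (S : Submodule ℂ (Matrix m n ℂ)) : ℕ :=
  sSup (Matrix.rank '' (S : Set (Matrix m n ℂ)))

noncomputable def tensorSpace {m₁ n₁ m₂ n₂ : Type*}
    (S : Submodule ℂ (Matrix m₁ n₁ ℂ)) (T : Submodule ℂ (Matrix m₂ n₂ ℂ)) :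
    Submodule ℂ (Matrix (m₁ × m₂) (n₁ × n₂) ℂ) :=
  Submodule.span ℂ {M | ∃ A ∈ S, ∃ B ∈ T, M = Matrix.kroneckerMap (· * ·) A B}

noncomputable def tensorPow {d : ℕ} (S : Submodule ℂ (Matrix (Fin d) (Fin d) ℂ)) (n : ℕ) :
    Submodule ℂ (Matrix (Fin n → Fin d) (Fin n → Fin d) ℂ) :=
  Submodule.span ℂ {M | ∃ A : Fin n → Matrix (Fin d) (Fin d) ℂ,
    (∀ k, A k ∈ S) ∧ M = fun i j => ∏ k, A k (i k) (j k)}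

noncomputable def spaceImageOf {ι κ : Type*} [Fintype κ]
    (S : Submodule ℂ (Matrix ι κ ℂ)) (U : Submodule ℂ (κ → ℂ)) : Submodule ℂ (ι → ℂ) :=
  Submodule.span ℂ {v | ∃ A ∈ S, ∃ u ∈ U, v = A.mulVec u}

def HasShrunkSubspace {ι : Type*} [Fintype ι]
    (S : Submodule ℂ (Matrix ι ι ℂ)) : Prop :=
  ∃ U : Submodule ℂ (ι → ℂ),
    Module.finrank ℂ (spaceImageOf S U) < Module.finrank ℂ U

noncomputable def compSpace (p q m n : ℕ) : Submodule ℂ (Matrix (Fin m) (Fin n) ℂ) where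
  carrier := {A | ∀ (i : Fin m) (j : Fin n), p ≤ (i : ℕ) → q ≤ (j : ℕ) → A i j = 0}
  add_mem' := by
    intro a b ha hb i j hi hj
    simp only [Matrix.add_apply, ha i j hi hj, hb i j hi hj, add_zero]
  zero_mem' := by intro i j _ _; rfl
  smul_mem' := by
    intro c a ha i j hi hj
    simp only [Matrix.smul_apply, ha i j hi hj, smul_zero]

noncomputable def spaceIm {m n : ℕ} (S : Submodule ℂ (Matrix (Fin m) (Fin n) ℂ)) :
    Submodule ℂ (Fin m → ℂ) :=
  Submodule.span ℂ {v | ∃ A ∈ S, ∃ u : Fin n → ℂ, v = A.mulVec u}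

noncomputable def spaceKer {m n : ℕ} (S : Submodule ℂ (Matrix (Fin m) (Fin n) ℂ)) :
    Submodule ℂ (Fin n → ℂ) :=
  ⨅ A ∈ S, LinearMap.ker (Matrix.mulVecLin A)

open scoped Kronecker in
theorem kronecker_mulVec_prod {l m n p : Type*} [Fintype n] [Fintype p]
    (A : Matrix l n ℂ) (B : Matrix m p ℂ) (v : n → ℂ) (w : p → ℂ) :
    (A ⊗ₖ B) *ᵥ (fun k => v k.1 * w k.2) = fun k => (A *ᵥ v) k.1 * (B *ᵥ w) k.2 := by
  ext k
  simp only [mulVec, dotProduct, kroneckerMap_apply, Finset.sum_mul_sum, Fintype.sum_prod_type]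
  exact Finset.sum_congr rfl fun i _ => Finset.sum_congr rfl fun j _ => by ring

/-- Every subspace of `ι → ℂ` is the image of a matrix with a left inverse. -/
theorem exists_matrix_leftInverse {ι : Type*} [Fintype ι] [DecidableEq ι]
    (W : Submodule ℂ (ι → ℂ)) :
    ∃ (C : Matrix ι (Fin (Module.finrank ℂ W)) ℂ) (D : Matrix (Fin (Module.finrank ℂ W)) ι ℂ),
      (∀ u, C *ᵥ u ∈ W) ∧ ∀ w ∈ W, (C * D) *ᵥ w = w := by
  let e := (Module.finBasis ℂ W).equivFun
  obtain ⟨g, hg⟩ := W.subtype.exists_leftInverse_of_injective W.ker_subtype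
  refine ⟨LinearMap.toMatrix' (W.subtype ∘ₗ e.symm.toLinearMap),
    LinearMap.toMatrix' (e.toLinearMap ∘ₗ g), fun u => ?_, fun w hw => ?_⟩
  · rw [LinearMap.toMatrix'_mulVec]
    simp
  · have h := LinearMap.congr_fun hg ⟨w, hw⟩
    rw [← mulVec_mulVec, LinearMap.toMatrix'_mulVec, LinearMap.toMatrix'_mulVec]
    simp only [LinearMap.comp_apply, Submodule.subtype_apply, LinearMap.id_apply] at h
    simp [h]

/-- Every subspace of `ι → ℂ` is the kernel of a matrix with a right inverse. -/
theorem exists_matrix_rightInverse {ι : Type*} [Fintype ι] [DecidableEq ι]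
    (K : Submodule ℂ (ι → ℂ)) :
    ∃ (C : Matrix ι (Fin (Module.finrank ℂ ((ι → ℂ) ⧸ K))) ℂ)
      (D : Matrix (Fin (Module.finrank ℂ ((ι → ℂ) ⧸ K))) ι ℂ),
      ∀ v, (C * D) *ᵥ v - v ∈ K := by
  let e := (Module.finBasis ℂ ((ι → ℂ) ⧸ K)).equivFun
  obtain ⟨g, hg⟩ := K.mkQ.exists_rightInverse_of_surjective K.range_mkQ
  refine ⟨LinearMap.toMatrix' (g ∘ₗ e.symm.toLinearMap),
    LinearMap.toMatrix' (e.toLinearMap ∘ₗ K.mkQ), fun v => ?_⟩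
  rw [← mulVec_mulVec, LinearMap.toMatrix'_mulVec, LinearMap.toMatrix'_mulVec]
  have h := LinearMap.congr_fun hg (K.mkQ v)
  rw [← Submodule.Quotient.mk_eq_zero, ← K.mkQ_apply, map_sub, sub_eq_zero]
  simpa using h

theorem exists_mul_mul_eq_one {ι κ : Type*} [Fintype ι] [DecidableEq ι] [Fintype κ] [DecidableEq κ]
    (A : Matrix ι κ ℂ) :
    ∃ (D : Matrix (Fin A.rank) ι ℂ) (F : Matrix κ (Fin A.rank) ℂ), D * A * F = 1 := by
  let b := Module.finBasis ℂ (LinearMap.range A.mulVecLin)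
  let e : (Fin A.rank → ℂ) →ₗ[ℂ] LinearMap.range A.mulVecLin := b.equivFun.symm.toLinearMap
  obtain ⟨s, hs⟩ := A.mulVecLin.rangeRestrict.exists_rightInverse_of_surjective
    A.mulVecLin.range_rangeRestrict
  obtain ⟨g, hg⟩ := (A.mulVecLin ∘ₗ s ∘ₗ e).exists_leftInverse_of_injective (by
    rw [LinearMap.ker_eq_bot]
    have : A.mulVecLin ∘ₗ s ∘ₗ e = (LinearMap.range A.mulVecLin).subtype ∘ₗ e := by
      rw [← LinearMap.comp_assoc]
      congr 1
      ext1 x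
      exact congrArg Subtype.val (LinearMap.congr_fun hs x)
    rw [this]
    exact Subtype.val_injective.comp b.equivFun.symm.injective)
  refine ⟨LinearMap.toMatrix' g, LinearMap.toMatrix' (s ∘ₗ e), ?_⟩
  apply Matrix.toLin'.injective
  rw [Matrix.mul_assoc, Matrix.toLin'_mul, Matrix.toLin'_mul, Matrix.toLin'_toMatrix',
    Matrix.toLin'_toMatrix', Matrix.toLin'_apply', hg, Matrix.toLin'_one]

open scoped Kronecker in
theorem rank_mul_rank_le_rank_kronecker {ι κ ι' κ' : Type*} [Fintype ι] [DecidableEq ι]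
    [Fintype κ] [DecidableEq κ] [Fintype ι'] [DecidableEq ι'] [Fintype κ'] [DecidableEq κ']
    (A : Matrix ι κ ℂ) (B : Matrix ι' κ' ℂ) : A.rank * B.rank ≤ (A ⊗ₖ B).rank := by
  obtain ⟨D, F, h⟩ := exists_mul_mul_eq_one A
  obtain ⟨D', F', h'⟩ := exists_mul_mul_eq_one B
  have h1 : (D ⊗ₖ D') * (A ⊗ₖ B) * (F ⊗ₖ F') = 1 := by
    rw [← mul_kronecker_mul, ← mul_kronecker_mul, h, h', one_kronecker_one]
  calc A.rank * B.rank = (1 : Matrix (Fin A.rank × Fin B.rank) _ ℂ).rank := by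
        rw [rank_one, Fintype.card_prod, Fintype.card_fin, Fintype.card_fin]
    _ = ((D ⊗ₖ D') * (A ⊗ₖ B) * (F ⊗ₖ F')).rank := by rw [h1]
    _ ≤ ((D ⊗ₖ D') * (A ⊗ₖ B)).rank := rank_mul_le_left _ _
    _ ≤ (A ⊗ₖ B).rank := rank_mul_le_right _ _

/-- If `X` maps some kernel vector of `A` outside the range of `A`, then some perturbation of `A`
in the direction `X` has larger rank. -/
theorem exists_rank_lt_rank_add_smul {ι κ : Type*} [Finite ι] [Fintype κ]
    (A X : Matrix ι κ ℂ) (v : κ → ℂ) (hv : A *ᵥ v = 0)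
    (hX : X *ᵥ v ∉ LinearMap.range A.mulVecLin) :
    ∃ t : ℂ, A.rank < (A + t • X).rank := by
  have := Fintype.ofFinite ι
  obtain ⟨b⟩ : Nonempty (Module.Basis (Fin A.rank) ℂ (LinearMap.range A.mulVecLin)) :=
    ⟨Module.finBasis ℂ (LinearMap.range A.mulVecLin)⟩
  choose u hu using fun i => (b i).2
  let f : ℂ → Option (Fin A.rank) → ι → ℂ := fun t o => o.elim (X *ᵥ v) fun i => (A + t • X) *ᵥ u i
  have hf : Continuous f := by
    refine continuous_pi fun o => ?_
    cases o with
    | none => exact continuous_const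
    | some i =>
      simp only [f, Option.elim_some, add_mulVec, smul_mulVec]
      fun_prop
  have h0 : LinearIndependent ℂ (f 0) := by
    rw [linearIndependent_option]
    have h : f 0 ∘ some = fun i => (b i : ι → ℂ) := by
      ext1 i
      simp only [f, Function.comp_apply, Option.elim_some, zero_smul, add_zero]
      exact hu i
    change LinearIndependent ℂ (f 0 ∘ some) ∧ X *ᵥ v ∉ Submodule.span ℂ (Set.range (f 0 ∘ some))
    rw [h]
    have hb : LinearIndependent ℂ fun i => (b i : ι → ℂ) :=
      LinearIndependent.map' (v := fun i => b i) b.linearIndependent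
        (LinearMap.range A.mulVecLin).subtype (Submodule.ker_subtype _)
    refine ⟨hb, fun hmem => hX ?_⟩
    have hspan : Submodule.span ℂ (Set.range fun i => (b i : ι → ℂ)) ≤
        LinearMap.range A.mulVecLin :=
      Submodule.span_le.2 (Set.range_subset_iff.2 fun i => (b i).2)
    exact hspan hmem
  have hopen := (isOpen_setOfPred_linearIndependent (𝕜 := ℂ) (E := ι → ℂ)
    (ι := Option (Fin A.rank))).preimage hf
  have hev : ∀ᶠ t in nhdsWithin (0 : ℂ) {0}ᶜ, LinearIndependent ℂ (f t) :=
    nhdsWithin_le_nhds (hopen.mem_nhds h0)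
  obtain ⟨t, ht, ht0⟩ := (hev.and self_mem_nhdsWithin).exists
  refine ⟨t, ?_⟩
  have hmem : ∀ o, f t o ∈ LinearMap.range (A + t • X).mulVecLin := by
    intro o
    cases o with
    | none =>
      refine ⟨t⁻¹ • v, ?_⟩
      have : t ≠ 0 := ht0
      simp [f, add_mulVec, hv, smul_mulVec, smul_smul, this]
    | some i => exact ⟨u i, rfl⟩
  have hli : LinearIndependent ℂ
      (fun o => (⟨f t o, hmem o⟩ : LinearMap.range (A + t • X).mulVecLin)) :=
    LinearIndependent.of_comp (LinearMap.range (A + t • X).mulVecLin).subtype ht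
  have hcard := hli.fintype_card_le_finrank
  rw [Fintype.card_option, Fintype.card_fin] at hcard
  exact hcard

theorem bddAbove_rank_image {m n : Type*} [Fintype n] (S : Submodule ℂ (Matrix m n ℂ)) :
    BddAbove (Matrix.rank '' (S : Set (Matrix m n ℂ))) :=
  ⟨Fintype.card n, by rintro _ ⟨A, _, rfl⟩; exact A.rank_le_card_width⟩

section mrk

variable {m n : Type*} [Fintype m] [Fintype n]

theorem rank_le_mrk {S : Submodule ℂ (Matrix m n ℂ)} {A : Matrix m n ℂ} (hA : A ∈ S) :
    A.rank ≤ mrk S :=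
  le_csSup (bddAbove_rank_image S) ⟨A, hA, rfl⟩

theorem exists_rank_eq_mrk (S : Submodule ℂ (Matrix m n ℂ)) : ∃ A ∈ S, A.rank = mrk S :=
  Nat.sSup_mem ⟨_, Set.mem_image_of_mem _ S.zero_mem⟩ (bddAbove_rank_image S)

theorem mrk_le {S : Submodule ℂ (Matrix m n ℂ)} {d : ℕ} (h : ∀ A ∈ S, A.rank ≤ d) : mrk S ≤ d := by
  obtain ⟨A, hA, hr⟩ := exists_rank_eq_mrk S
  exact hr ▸ h A hA

end mrk

section tensorSpace

variable {m n : Type*} [Fintype m] [Fintype n]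

open scoped Kronecker

theorem kronecker_mem_tensorSpace {m₁ n₁ m₂ n₂ : Type*} {S : Submodule ℂ (Matrix m₁ n₁ ℂ)}
    {T : Submodule ℂ (Matrix m₂ n₂ ℂ)} {A : Matrix m₁ n₁ ℂ} {B : Matrix m₂ n₂ ℂ}
    (hA : A ∈ S) (hB : B ∈ T) : A ⊗ₖ B ∈ tensorSpace S T :=
  Submodule.subset_span ⟨A, hA, B, hB, rfl⟩

theorem mrk_tensorSpace_self_le_of_mul_left {d : ℕ} {S : Submodule ℂ (Matrix m n ℂ)}
    (C : Matrix m (Fin d) ℂ) (D : Matrix (Fin d) m ℂ) (h : ∀ A ∈ S, C * D * A = A) :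
    mrk (tensorSpace S S) ≤ d ^ 2 := by
  refine mrk_le fun M hM => ?_
  have hfix : (C ⊗ₖ C) * ((D ⊗ₖ D) * M) = M := by
    rw [← Matrix.mul_assoc, ← mul_kronecker_mul]
    induction hM using Submodule.span_induction with
    | mem M hM =>
      obtain ⟨A, hA, B, hB, rfl⟩ := hM
      rw [← mul_kronecker_mul, h A hA, h B hB]
    | zero => simp
    | add M N _ _ hM hN => rw [Matrix.mul_add, hM, hN]
    | smul c M _ hM => rw [Matrix.mul_smul, hM]
  calc M.rank = ((C ⊗ₖ C) * ((D ⊗ₖ D) * M)).rank := by rw [hfix]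
    _ ≤ (C ⊗ₖ C).rank := rank_mul_le_left _ _
    _ ≤ Fintype.card (Fin d × Fin d) := rank_le_card_width _
    _ = d ^ 2 := by simp [sq]

theorem mrk_tensorSpace_self_le_of_mul_right {d : ℕ} {S : Submodule ℂ (Matrix m n ℂ)}
    (C : Matrix n (Fin d) ℂ) (D : Matrix (Fin d) n ℂ) (h : ∀ A ∈ S, A * (C * D) = A) :
    mrk (tensorSpace S S) ≤ d ^ 2 := by
  refine mrk_le fun M hM => ?_
  have hfix : M * (C ⊗ₖ C) * (D ⊗ₖ D) = M := by
    rw [Matrix.mul_assoc, ← mul_kronecker_mul]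
    induction hM using Submodule.span_induction with
    | mem M hM =>
      obtain ⟨A, hA, B, hB, rfl⟩ := hM
      rw [← mul_kronecker_mul, h A hA, h B hB]
    | zero => simp
    | add M N _ _ hM hN => rw [Matrix.add_mul, hM, hN]
    | smul c M _ hM => rw [Matrix.smul_mul, hM]
  calc M.rank = (M * (C ⊗ₖ C) * (D ⊗ₖ D)).rank := by rw [hfix]
    _ ≤ (M * (C ⊗ₖ C)).rank := rank_mul_le_left _ _
    _ ≤ Fintype.card (Fin d × Fin d) := rank_le_card_width _
    _ = d ^ 2 := by simp [sq]

/-- If `A ∈ S` has a kernel vector not killed by `B ∈ S` and `C ∈ S` has an image vector outside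
the range of `A`, then the square of the rank of `A` is exceeded in `S ⊗ S`. -/
theorem rank_sq_lt_mrk_tensorSpace_self [DecidableEq m] [DecidableEq n]
    {S : Submodule ℂ (Matrix m n ℂ)} {A B C : Matrix m n ℂ} (hA : A ∈ S) (hB : B ∈ S) (hC : C ∈ S)
    {v w : n → ℂ} (hAv : A *ᵥ v = 0) (hBv : B *ᵥ v ≠ 0)
    (hCw : C *ᵥ w ∉ LinearMap.range A.mulVecLin) :
    A.rank ^ 2 < mrk (tensorSpace S S) := by
  obtain ⟨E, F, hE, hEF⟩ := exists_matrix_leftInverse (LinearMap.range A.mulVecLin)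
  have hPA : (1 - E * F) * A = 0 := by
    refine Matrix.ext_of_mulVec_single fun j => ?_
    rw [← mulVec_mulVec, sub_mulVec, hEF (A *ᵥ _) ⟨_, rfl⟩, one_mulVec, sub_self, zero_mulVec]
  have hPC : (1 - E * F) *ᵥ (C *ᵥ w) ≠ 0 := by
    intro h
    rw [sub_mulVec, one_mulVec, sub_eq_zero] at h
    rw [h, ← mulVec_mulVec] at hCw
    exact hCw (hE _)
  have hX : (B ⊗ₖ C) *ᵥ (fun k => v k.1 * w k.2) ∉ LinearMap.range (A ⊗ₖ A).mulVecLin := by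
    rintro ⟨z, hz⟩
    have h : ((1 : Matrix m m ℂ) ⊗ₖ (1 - E * F)) *ᵥ ((A ⊗ₖ A) *ᵥ z) = 0 := by
      rw [mulVec_mulVec, ← mul_kronecker_mul, hPA, kronecker_zero, zero_mulVec]
    rw [mulVecLin_apply] at hz
    rw [hz, kronecker_mulVec_prod, kronecker_mulVec_prod, one_mulVec] at h
    obtain ⟨i, hi⟩ := Function.ne_iff.1 hBv
    obtain ⟨j, hj⟩ := Function.ne_iff.1 hPC
    exact mul_ne_zero hi hj (congrFun h (i, j))
  obtain ⟨t, ht⟩ := exists_rank_lt_rank_add_smul (A ⊗ₖ A) (B ⊗ₖ C) _ (by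
    rw [kronecker_mulVec_prod, hAv]
    ext k
    simp) hX
  calc A.rank ^ 2 = A.rank * A.rank := sq _
    _ ≤ (A ⊗ₖ A).rank := rank_mul_rank_le_rank_kronecker A A
    _ < (A ⊗ₖ A + t • (B ⊗ₖ C)).rank := ht
    _ ≤ mrk (tensorSpace S S) := rank_le_mrk (add_mem (kronecker_mem_tensorSpace hA hA)
        (Submodule.smul_mem _ t (kronecker_mem_tensorSpace hB hC)))

end tensorSpace

theorem stmt4 {m n : ℕ} (S : Submodule ℂ (Matrix (Fin m) (Fin n) ℂ)) (hS : S ≠ ⊥) :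
    (mrk S) ^ 2 < mrk (tensorSpace S S) ↔
      mrk S < Module.finrank ℂ (spaceIm S) ∧
      mrk S < n - Module.finrank ℂ (spaceKer S) := by
  constructor
  · intro h
    constructor
    · obtain ⟨C, D, -, hCD⟩ := exists_matrix_leftInverse (spaceIm S)
      refine lt_of_pow_lt_pow_left₀ 2 (Nat.zero_le _) (h.trans_le
        (mrk_tensorSpace_self_le_of_mul_left C D fun A hA => ?_))
      refine Matrix.ext_of_mulVec_single fun j => ?_
      rw [← mulVec_mulVec]
      exact hCD _ (Submodule.subset_span ⟨A, hA, _, rfl⟩)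
    · obtain ⟨C, D, hCD⟩ := exists_matrix_rightInverse (spaceKer S)
      have hd := (spaceKer S).finrank_quotient (R := ℂ)
      rw [Module.finrank_fin_fun] at hd
      rw [← hd]
      refine lt_of_pow_lt_pow_left₀ 2 (Nat.zero_le _) (h.trans_le
        (mrk_tensorSpace_self_le_of_mul_right C D fun A hA => ?_))
      refine Matrix.ext_of_mulVec_single fun j => ?_
      have hj := hCD (Pi.single j 1)
      simp only [spaceKer, Submodule.mem_iInf] at hj
      have hj := hj A hA
      rwa [LinearMap.mem_ker, mulVecLin_apply, mulVec_sub, mulVec_mulVec, sub_eq_zero] at hj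
  · rintro ⟨hIm, hKer⟩
    obtain ⟨A, hA, hr⟩ := exists_rank_eq_mrk S
    rw [← hr] at hIm hKer ⊢
    obtain ⟨B, hB, v, hAv, hBv⟩ : ∃ B ∈ S, ∃ v, A *ᵥ v = 0 ∧ B *ᵥ v ≠ 0 := by
      by_contra! hcon
      have hle : LinearMap.ker A.mulVecLin ≤ spaceKer S :=
        le_iInf₂ fun B hB v hv => hcon B hB v hv
      have h1 := Submodule.finrank_mono hle
      have h2 := A.mulVecLin.finrank_range_add_finrank_ker
      rw [Module.finrank_fin_fun] at h2
      have h3 : A.rank = Module.finrank ℂ (LinearMap.range A.mulVecLin) := rfl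
      omega
    obtain ⟨C, hC, w, hCw⟩ : ∃ C ∈ S, ∃ w, C *ᵥ w ∉ LinearMap.range A.mulVecLin := by
      by_contra! hcon
      have hle : spaceIm S ≤ LinearMap.range A.mulVecLin :=
        Submodule.span_le.2 (by rintro _ ⟨C, hC, w, rfl⟩; exact hcon C hC w)
      exact hIm.not_ge (Submodule.finrank_mono hle)
    exact rank_sq_lt_mrk_tensorSpace_self hA hB hC hAv hBv hCw
end

section
/- Let p, q, d be natural numbers with p ≥ 1, q ≥ 1 and p+q < d, and let N ≥ 0 and 0 ≤ k ≤ N be integers. Then mrk(A(p^{N−k+1}(d−p)^k, q^{k+1}(d−q)^{N−k}, p^{N−k}(d−p)^k·d, q^k(d−q)^{N−k}·d)) = min{p^{N−k+1}(d−p)^k, q^k(d−q)^{N−k+1}} + min{q^{k+1}(d−q)^{N−k}, p^{N−k}(d−p)^{k+1}}. -/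
open Matrix

theorem Matrix.rank_add_le {m n K : Type*} [Fintype n] [Finite m] [Field K] (A B : Matrix m n K) :
    (A + B).rank ≤ A.rank + B.rank := by
  rw [Matrix.rank, Matrix.mulVecLin_add]
  exact (Submodule.finrank_mono (LinearMap.range_add_le _ _)).trans
    (Submodule.finrank_add_le_finrank_add_finrank _ _)

theorem Matrix.rank_diagonal_ite_val_lt_le (m p : ℕ) :
    (Matrix.diagonal fun i : Fin m => if (i : ℕ) < p then (1 : ℂ) else 0).rank ≤ p := by
  rw [Matrix.rank_diagonal]
  let f : {i : Fin m // (if (i : ℕ) < p then (1 : ℂ) else 0) ≠ 0} → Fin p := fun i =>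
    ⟨i.1, by have h := i.2; by_contra hlt; simp [hlt] at h⟩
  have hf : Function.Injective f := fun i j hij =>
    Subtype.ext (Fin.ext (by simpa [f] using hij))
  simpa using Fintype.card_le_of_injective f hf

theorem rank_le_add_of_mem_compSpace {p q m n : ℕ} {A : Matrix (Fin m) (Fin n) ℂ}
    (hA : A ∈ compSpace p q m n) : A.rank ≤ p + q := by
  set D := Matrix.diagonal fun i : Fin m => if (i : ℕ) < p then (1 : ℂ) else 0 with hD
  set E := Matrix.diagonal fun j : Fin n => if (j : ℕ) < q then (1 : ℂ) else 0 with hE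
  have hdecomp : A = D * A + (A - D * A) * E := by
    ext i j
    have hij : p ≤ (i : ℕ) → q ≤ (j : ℕ) → A i j = 0 := hA i j
    simp only [hD, hE, Matrix.add_apply, Matrix.mul_diagonal, Matrix.sub_apply,
      Matrix.diagonal_mul]
    split_ifs with hi hj hj <;> simp
    exact hij (not_lt.mp hi) (not_lt.mp hj)
  calc A.rank = (D * A + (A - D * A) * E).rank := congrArg _ hdecomp
    _ ≤ (D * A).rank + ((A - D * A) * E).rank := Matrix.rank_add_le _ _
    _ ≤ D.rank + E.rank :=
      add_le_add (Matrix.rank_mul_le_left _ _) (Matrix.rank_mul_le_right _ _)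
    _ ≤ p + q := add_le_add (Matrix.rank_diagonal_ite_val_lt_le m p)
      (Matrix.rank_diagonal_ite_val_lt_le n q)

theorem exists_mem_compSpace_le_rank {p q m n : ℕ} (hp : p ≤ m) (hq : q ≤ n) :
    ∃ A ∈ compSpace p q m n, min p (n - q) + min q (m - p) ≤ A.rank := by
  set r := min p (n - q) with hr
  set s := min q (m - p) with hs
  let f : Fin r ⊕ Fin s → Fin m :=
    Sum.elim (fun i => ⟨i, by omega⟩) fun j => ⟨p + j, by omega⟩
  let g : Fin r ⊕ Fin s → Fin n :=
    Sum.elim (fun i => ⟨q + i, by omega⟩) fun j => ⟨j, by omega⟩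
  let A : Matrix (Fin m) (Fin n) ℂ := Matrix.of fun i j =>
    if (i : ℕ) < p ∧ (j : ℕ) = q + i ∨ (j : ℕ) < q ∧ (i : ℕ) = p + j then 1 else 0
  refine ⟨A, fun i j hi hj => if_neg (by omega), ?_⟩
  have hone : A.submatrix f g = 1 := by
    ext x y
    rw [Matrix.one_apply]
    refine if_congr ?_ rfl rfl
    rcases x with i | i <;> rcases y with j | j <;>
      simp only [f, g, Sum.elim_inl, Sum.elim_inr, Sum.inl.injEq, Sum.inr.injEq, reduceCtorEq,
        Fin.ext_iff, iff_false] <;>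
      omega
  calc r + s = (1 : Matrix (Fin r ⊕ Fin s) (Fin r ⊕ Fin s) ℂ).rank := by simp
    _ = (A.submatrix f g).rank := by rw [hone]
    _ ≤ A.rank := Matrix.rank_submatrix_le _ _ _

theorem mrk_compSpace {p q m n : ℕ} (hp : p ≤ m) (hq : q ≤ n)
    (h : p ≤ n - q ∨ q ≤ m - p) :
    mrk (compSpace p q m n) = min p (n - q) + min q (m - p) := by
  have hub : ∀ r ∈ Matrix.rank '' (compSpace p q m n : Set (Matrix (Fin m) (Fin n) ℂ)),
      r ≤ min p (n - q) + min q (m - p) := by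
    rintro _ ⟨A, hA, rfl⟩
    have hpq := rank_le_add_of_mem_compSpace hA
    have hm : A.rank ≤ m := by simpa using A.rank_le_card_height
    have hn : A.rank ≤ n := by simpa using A.rank_le_card_width
    omega
  obtain ⟨A, hA, hrank⟩ := exists_mem_compSpace_le_rank hp hq
  exact le_antisymm (csSup_le ⟨_, A, hA, rfl⟩ hub)
    (hrank.trans (le_csSup ⟨_, hub⟩ ⟨A, hA, rfl⟩))

theorem stmt15 {p q d : ℕ} (hp : 1 ≤ p) (hq : 1 ≤ q) (hpq : p + q < d)
    (N k : ℕ) (hk : k ≤ N) :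
    mrk (compSpace (p ^ (N - k + 1) * (d - p) ^ k) (q ^ (k + 1) * (d - q) ^ (N - k))
        (p ^ (N - k) * (d - p) ^ k * d) (q ^ k * (d - q) ^ (N - k) * d)) =
      min (p ^ (N - k + 1) * (d - p) ^ k) (q ^ k * (d - q) ^ (N - k + 1)) +
      min (q ^ (k + 1) * (d - q) ^ (N - k)) (p ^ (N - k) * (d - p) ^ (k + 1)) := by
  obtain ⟨a, rfl⟩ : ∃ a, d = p + a := ⟨d - p, by omega⟩
  obtain ⟨b, hb⟩ : ∃ b, p + a = q + b := ⟨p + a - q, by omega⟩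
  have hda : p + a - p = a := by omega
  have hdb : p + a - q = b := by omega
  have hqa : q < a := by omega
  have hpb : p < b := by omega
  rw [hda, hdb]
  set x := p ^ (N - k) * a ^ k with hx
  set y := q ^ k * b ^ (N - k) with hy
  have hP : p ^ (N - k + 1) * a ^ k = x * p := by rw [hx]; ring
  have hQ : q ^ (k + 1) * b ^ (N - k) = y * q := by rw [hy]; ring
  have hP' : p ^ (N - k) * a ^ (k + 1) = x * a := by rw [hx]; ring
  have hQ' : q ^ k * b ^ (N - k + 1) = y * b := by rw [hy]; ring
  have hm : x * (p + a) - x * p = x * a := by rw [mul_add]; omega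
  have hn : y * (p + a) - y * q = y * b := by rw [hb, mul_add]; omega
  rw [hP, hQ, hP', hQ', mrk_compSpace, hm, hn]
  · exact Nat.mul_le_mul_left _ (by omega)
  · exact Nat.mul_le_mul_left _ (by omega)
  · rw [hm, hn]
    rcases le_total x y with hxy | hxy
    · exact Or.inl (Nat.mul_le_mul hxy hpb.le)
    · exact Or.inr (Nat.mul_le_mul hxy hqa.le)
end
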